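/- Under these hypotheses, if there exists some real δ₀ > 0 such that Q(δ₀) holds, then Q(δ) holds for every real δ > 0. (Abstract metric form of the geometric formulation of Faltings' theorem: for every positive δ and c, only finitely many points of the finitely generated subgroup outside a geometrically irreducible subvariety E satisfy dist(x, E) < c·H(x)^{−δ}.) -/

import Mathlib

/-- `SetApproxFinite h F δ` is the property `Q(δ)`: for every nonempty closed subset
`E` of `X` and every real `C > 0`, the set
`{x ∈ F : x ∉ E ∧ infDist x E ≤ C · exp (−δ · h x)}` is finite. -/
def SetApproxFinite {X : Type*} [MetricSpace X] (h : X → ℝ) (F : Set X) (δ : ℝ) : Prop :=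
  ∀ E : Set X, E.Nonempty → IsClosed E → ∀ C : ℝ, 0 < C →
    {x ∈ F | x ∉ E ∧ Metric.infDist x E ≤ C * Real.exp (-δ * h x)}.Finite

theorem SetApproxFinite.mono {X : Type*} [MetricSpace X] {h : X → ℝ} {F : Set X} {δ δ' : ℝ}
    (hnonneg : ∀ x ∈ F, 0 ≤ h x) (hδ : δ ≤ δ') (H : SetApproxFinite h F δ) :
    SetApproxFinite h F δ' := by
  intro E hE hEc C hC
  refine (H E hE hEc C hC).subset ?_
  rintro x ⟨hxF, hxE, hx⟩
  refine ⟨hxF, hxE, hx.trans ?_⟩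
  have := mul_le_mul_of_nonneg_right hδ (hnonneg x hxF)
  gcongr C * Real.exp ?_
  linarith

/-- Pulling `E` back along the maps `φ i` trades the exponent `m * δ` for `δ`. -/
theorem SetApproxFinite.of_mul {X : Type*} [MetricSpace X] [CompactSpace X]
    {h : X → ℝ} {F : Set X} {ι : Type*} [Finite ι] {φ : ι → X → X}
    (hφcont : ∀ i, Continuous (φ i))
    {m C₁ c r : ℝ} (hc : 0 < c) (hr : 0 < r)
    (hcover : ∀ x ∈ F, ∃ i, ∃ y ∈ F, φ i y = x)
    (hheight : ∀ i, ∀ y ∈ F, m * h y - C₁ ≤ h (φ i y))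
    (hcovlaw : ∀ i, ∀ x e : X, dist (φ i x) e ≤ r →
      ∃ x' : X, φ i x' = e ∧ dist x x' ≤ (1 / c) * dist (φ i x) e)
    (hNorthcott : ∀ B : ℝ, {x ∈ F | h x ≤ B}.Finite)
    {δ : ℝ} (hδ : 0 < δ) (H : SetApproxFinite h F (m * δ)) :
    SetApproxFinite h F δ := by
  intro E hE hEc C hC
  set K : ℝ := (1 / c) * (C * Real.exp (δ * C₁)) with hK_def
  have hK : 0 < K := by positivity
  have hfin : ∀ i, {y ∈ F | (φ i ⁻¹' E).Nonempty ∧ y ∉ φ i ⁻¹' E ∧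
      Metric.infDist y (φ i ⁻¹' E) ≤ K * Real.exp (-(m * δ) * h y)}.Finite := by
    intro i
    by_cases hne : (φ i ⁻¹' E).Nonempty
    · simpa [hne] using H _ hne (hEc.preimage (hφcont i)) K hK
    · simp [hne]
  refine ((hNorthcott (-Real.log (r / C) / δ)).union
    (Set.finite_iUnion fun i => (hfin i).image (φ i))).subset ?_
  rintro x ⟨hxF, hxE, hx⟩
  by_cases hB : h x ≤ -Real.log (r / C) / δ
  · exact Or.inl ⟨hxF, hB⟩
  right
  have hsmall : C * Real.exp (-δ * h x) ≤ r := by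
    rw [not_le, div_lt_iff₀ hδ] at hB
    have : Real.exp (-δ * h x) ≤ r / C := by
      rw [← Real.le_log_iff_exp_le (by positivity)]
      linarith
    rwa [le_div_iff₀' hC] at this
  obtain ⟨i, y, hyF, rfl⟩ := hcover x hxF
  obtain ⟨e, heE, he⟩ := hEc.isCompact.exists_infDist_eq_dist hE (φ i y)
  rw [he] at hx
  obtain ⟨x', rfl, hx'⟩ := hcovlaw i y e (hx.trans hsmall)
  refine Set.mem_iUnion.2 ⟨i, y, ⟨hyF, ⟨x', heE⟩, hxE, ?_⟩, rfl⟩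
  have hexp : Real.exp (-δ * h (φ i y)) ≤
      Real.exp (δ * C₁) * Real.exp (-(m * δ) * h y) := by
    rw [← Real.exp_add, Real.exp_le_exp]
    linarith [mul_le_mul_of_nonneg_left (hheight i y hyF) hδ.le]
  calc Metric.infDist y (φ i ⁻¹' E) ≤ dist y x' := Metric.infDist_le_dist_of_mem heE
    _ ≤ (1 / c) * dist (φ i y) (φ i x') := hx'
    _ ≤ (1 / c) * (C * (Real.exp (δ * C₁) * Real.exp (-(m * δ) * h y))) := by
      gcongr
      exact hx.trans (by gcongr)
    _ = K * Real.exp (-(m * δ) * h y) := by rw [hK_def]; ring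

/-- Abstract metric form of the geometric formulation of Faltings' theorem:
under the covering, height-expansion, local covering law, Northcott and
nonnegativity hypotheses, if `Q(δ₀)` holds for some `δ₀ > 0`, then `Q(δ)` holds
for every `δ > 0`. -/
theorem faltings_geometric {X : Type*} [MetricSpace X] [CompactSpace X]
    (h : X → ℝ) (F : Set X) (k : ℕ) (φ : Fin k → X → X)
    (hφcont : ∀ i, Continuous (φ i))
    (m C₁ c r : ℝ) (hm : 1 < m) (hC₁ : 0 ≤ C₁) (hc : 0 < c) (hr : 0 < r)
    (hcover : ∀ x ∈ F, ∃ i, ∃ y ∈ F, φ i y = x)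
    (hheight : ∀ i, ∀ y ∈ F, m * h y - C₁ ≤ h (φ i y))
    (hcovlaw : ∀ i, ∀ x e : X, dist (φ i x) e ≤ r →
      ∃ x' : X, φ i x' = e ∧ dist x x' ≤ (1 / c) * dist (φ i x) e)
    (hNorthcott : ∀ B : ℝ, {x ∈ F | h x ≤ B}.Finite)
    (hnonneg : ∀ x ∈ F, 0 ≤ h x)
    (hδ₀ : ∃ δ₀ : ℝ, 0 < δ₀ ∧ SetApproxFinite h F δ₀) :
    ∀ δ : ℝ, 0 < δ → SetApproxFinite h F δ := by
  obtain ⟨δ₀, -, H₀⟩ := hδ₀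
  intro δ hδ
  obtain ⟨n, hn⟩ := pow_unbounded_of_one_lt (δ₀ / δ) hm
  rw [div_lt_iff₀ hδ] at hn
  have descend : ∀ n : ℕ, ∀ δ : ℝ, 0 < δ → SetApproxFinite h F (m ^ n * δ) →
      SetApproxFinite h F δ := by
    intro n
    induction n with
    | zero => intro δ _ H; simpa using H
    | succ n ih =>
      intro δ hδ H
      refine SetApproxFinite.of_mul hφcont hc hr hcover hheight hcovlaw hNorthcott hδ
        (ih (m * δ) (by positivity) ?_)
      rwa [← mul_assoc, ← pow_succ]
  exact descend n δ hδ (H₀.mono hnonneg hn.le)
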